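/- Define t : ℕ → ℕ by t(0) = 0 and t(n) = t(n−1) + 2^n·(n−1) + 1 for n ≥ 1. Let d, m < ω and set k = t(d) + m. Let A be a finite set, let 𝓗 be a family of subsets of A of VC dimension at most d, let a_0, …, a_{m−1} ∈ A and ε_0, …, ε_{m−1} ∈ {0,1}, and suppose there exists h ∈ 𝓗 with (a_i ∈ h ⟺ ε_i = 1) for all i < m. Then there exist h₀ ∈ 𝓗 with (a_i ∈ h₀ ⟺ ε_i = 1) for all i < m, and A₀ ⊆ A with |A₀| ≤ k, such that for every h' ∈ 𝓗: if h' ∩ A₀ = h₀ ∩ A₀ then h' = h₀. -/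

import Mathlib

/-- A family of subsets `F` of `X` shatters `B` if every subset of `B` is cut out by a
member of `F`. -/
def SetShatters {X : Type*} (F : Set (Set X)) (B : Set X) : Prop :=
  ∀ S ⊆ B, ∃ f ∈ F, f ∩ B = S

/-- The VC dimension of the family `F` is at most `n`: no finite set of size `> n` is
shattered by `F`. -/
def VCDimLE {X : Type*} (F : Set (Set X)) (n : ℕ) : Prop :=
  ∀ B : Finset X, SetShatters F ↑B → B.card ≤ n

/-- The recursive bound `t(0) = 0`, `t(n) = t(n-1) + 2^n * (n-1) + 1` for `n ≥ 1`. -/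
def tFun : ℕ → ℕ
  | 0 => 0
  | n + 1 => tFun n + 2 ^ (n + 1) * n + 1

theorem inter_eq_inter_iff_forall_mem {X : Type*} {s t B : Set X} :
    s ∩ B = t ∩ B ↔ ∀ x ∈ B, (x ∈ s ↔ x ∈ t) := by
  simp only [Set.ext_iff, Set.mem_inter_iff, and_congr_left_iff]

theorem setShatters_iff {X : Type*} {F : Set (Set X)} {B : Set X} :
    SetShatters F B ↔ ∀ S : Set X, ∃ f ∈ F, ∀ x ∈ B, (x ∈ f ↔ x ∈ S) := by
  constructor
  · intro h S
    obtain ⟨f, hf, hfS⟩ := h (S ∩ B) Set.inter_subset_right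
    exact ⟨f, hf, inter_eq_inter_iff_forall_mem.1 hfS⟩
  · intro h S hS
    obtain ⟨f, hf, hfS⟩ := h S
    refine ⟨f, hf, ?_⟩
    rw [inter_eq_inter_iff_forall_mem.2 hfS, Set.inter_eq_left.2 hS]

theorem VCDimLE.mono {X : Type*} {F G : Set (Set X)} {n : ℕ} (hG : VCDimLE G n)
    (hFG : F ⊆ G) : VCDimLE F n := fun B hB => hG B fun S hS =>
  let ⟨f, hf, hfS⟩ := hB S hS
  ⟨f, hFG hf, hfS⟩

theorem VCDimLE.subsingleton {X : Type*} {F : Set (Set X)} (hF : VCDimLE F 0) :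
    F.Subsingleton := by
  intro f hf g hg
  by_contra hne
  obtain ⟨x, hx⟩ : ∃ x, ¬(x ∈ f ↔ x ∈ g) := by
    by_contra! h
    exact hne (Set.ext h)
  have hshat : SetShatters F ↑({x} : Finset X) := by
    rw [setShatters_iff]
    intro S
    by_cases hxS : x ∈ f ↔ x ∈ S
    · exact ⟨f, hf, by simpa using hxS⟩
    · exact ⟨g, hg, by simp only [Finset.coe_singleton, Set.mem_singleton_iff, forall_eq]; tauto⟩
  simpa using hF _ hshat

/-- The members of `F` which agree with `h` on `Y`. -/
def agreeing {X : Type*} (F : Set (Set X)) (Y : Finset X) (h : Set X) : Set (Set X) :=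
  {f ∈ F | ∀ x ∈ Y, (x ∈ f ↔ x ∈ h)}

/-- If the members of `F` agreeing with `h` on `Y` shatter a set `Z` of the largest size `n + 1`
that `F` can shatter, then part of `Y` can be exchanged for `Z` so as to get strictly fewer members
of `F` that agree with some `g ∈ F`. -/
theorem exists_agreeing_ssubset {X : Type*} {F : Set (Set X)} {n : ℕ} (hF : VCDimLE F (n + 1))
    {Y Z : Finset X} (hY : 2 ^ (n + 1) * n < Y.card) (hZ : Z.card = n + 1) {h : Set X}
    (hshat : SetShatters (agreeing F Y h) ↑Z) :
    ∃ Y' : Finset X, Y'.card = Y.card ∧ ∃ g ∈ F, agreeing F Y' g ⊂ agreeing F Y h := by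
  classical
  rw [setShatters_iff] at hshat
  have hdisj : ∀ w ∈ Y, w ∉ Z := by
    intro w hwY hwZ
    obtain ⟨f, hf, hfS⟩ := hshat {x | x ∉ h}
    have h₁ := hf.2 w hwY
    have h₂ := hfS w hwZ
    simp only [Set.mem_ofPred_eq] at h₂
    tauto
  have hpat : ∀ w ∈ Y, ∃ T ∈ Z.powerset,
      ∀ f ∈ F, (∀ x ∈ Z, (x ∈ f ↔ x ∈ T)) → (w ∈ f ↔ w ∈ h) := by
    intro w hw
    by_contra! hcon
    have hbig : SetShatters F ↑(insert w Z) := by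
      rw [setShatters_iff]
      intro S
      by_cases hwS : w ∈ h ↔ w ∈ S
      · obtain ⟨f, hf, hfS⟩ := hshat S
        refine ⟨f, hf.1, fun x hx => ?_⟩
        rcases Finset.mem_insert.1 (Finset.mem_coe.1 hx) with rfl | hx
        · exact (hf.2 x hw).trans hwS
        · exact hfS x hx
      · obtain ⟨f, hf, hfS, hfw⟩ := hcon (Z.filter (· ∈ S)) (by simp)
        refine ⟨f, hf, fun x hx => ?_⟩
        rcases Finset.mem_insert.1 (Finset.mem_coe.1 hx) with rfl | hx
        · tauto
        · rw [hfS x hx, Finset.mem_filter, and_iff_right hx]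
    have := hF _ hbig
    rw [Finset.card_insert_of_notMem (hdisj w hw)] at this
    omega
  choose! T hTZ hT using hpat
  obtain ⟨P, -, hP⟩ := Finset.exists_lt_card_fiber_of_mul_lt_card_of_maps_to hTZ
    (n := n) (by rwa [Finset.card_powerset, hZ])
  obtain ⟨W, hW, hWcard⟩ := Finset.exists_subset_card_eq (Nat.succ_le_of_lt hP)
  have hWY : W ⊆ Y := hW.trans (Finset.filter_subset _ _)
  obtain ⟨g, hg, hgP⟩ := hshat ↑P
  refine ⟨(Y \ W) ∪ Z, ?_, g, hg.1, ?_⟩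
  · rw [Finset.card_union_of_disjoint, Finset.card_sdiff_of_subset hWY]
    · have := Finset.card_le_card hWY
      omega
    · exact Finset.disjoint_left.2 fun w hw => hdisj w (Finset.mem_sdiff.1 hw).1
  · rw [Set.ssubset_iff_exists]
    constructor
    · rintro f ⟨hfF, hf⟩
      refine ⟨hfF, fun x hx => ?_⟩
      by_cases hxW : x ∈ W
      · have hxP : T x = P := (Finset.mem_filter.1 (hW hxW)).2
        refine hT x hx f hfF fun z hz => ?_
        rw [hxP, hf z (Finset.mem_union_right _ hz), hgP z hz, Finset.mem_coe]
      · rw [hf x (by simp [hx, hxW]), hg.2 x hx]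
    · obtain ⟨f, hf, hfP⟩ := hshat {x | x ∉ P}
      refine ⟨f, hf, fun hf' => ?_⟩
      obtain ⟨z, hz⟩ : Z.Nonempty := Finset.card_pos.1 (by omega)
      have h₁ := hfP z hz
      have h₂ := hf'.2 z (Finset.mem_union_right _ hz)
      have h₃ := hgP z hz
      simp only [Set.mem_ofPred_eq, Finset.mem_coe] at h₁ h₃
      tauto

/-- A nonempty family of VC dimension at most `d` on a finite set has a member isolated by its
trace on a set of size at most `tFun d`. -/
theorem VCDimLE.exists_isolated {X : Type*} [Finite X] (d : ℕ) {F : Set (Set X)}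
    (hF : VCDimLE F d) (hne : F.Nonempty) :
    ∃ h ∈ F, ∃ Y : Finset X, Y.card ≤ tFun d ∧ ∀ f ∈ F, (∀ x ∈ Y, (x ∈ f ↔ x ∈ h)) → f = h := by
  classical
  have := Fintype.ofFinite X
  induction d generalizing F with
  | zero =>
    obtain ⟨h, hh⟩ := hne
    exact ⟨h, hh, ∅, by simp, fun f hf _ => hF.subsingleton hf hh⟩
  | succ n ih =>
    obtain ⟨h, hh⟩ := hne
    by_cases hcard : 2 ^ (n + 1) * n + 1 ≤ Fintype.card X
    · obtain ⟨Y, -, hY⟩ := Finset.exists_subset_card_eq (s := Finset.univ) hcard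
      obtain ⟨⟨Y, h⟩, ⟨hY, hh⟩, hmin⟩ := Set.exists_min_image
        {p : Finset X × Set X | p.1.card = 2 ^ (n + 1) * n + 1 ∧ p.2 ∈ F}
        (fun p => (agreeing F p.1 p.2).ncard) (Set.toFinite _) ⟨(Y, h), hY, hh⟩
      have hVC : VCDimLE (agreeing F Y h) n := by
        intro Z hZ
        by_contra! hlt
        have hle := hF.mono (fun f hf => hf.1) Z hZ
        obtain ⟨Y', hY', g, hg, hss⟩ :=
          exists_agreeing_ssubset hF (by rw [hY]; exact Nat.lt_succ_self _)
            (le_antisymm hle hlt) hZ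
        exact (Set.ncard_lt_ncard hss (Set.toFinite _)).not_ge (hmin (Y', g) ⟨hY'.trans hY, hg⟩)
      obtain ⟨h₀, hh₀, Y₀, hY₀, hiso⟩ := ih hVC ⟨h, hh, fun _ _ => Iff.rfl⟩
      refine ⟨h₀, hh₀.1, Y₀ ∪ Y, ?_, fun f hf hfY => ?_⟩
      · have := Finset.card_union_le Y₀ Y
        simp only [tFun]
        simp only at hY
        omega
      · refine hiso f ⟨hf, fun x hx => ?_⟩ fun x hx => hfY x (Finset.mem_union_left _ hx)
        rw [hfY x (Finset.mem_union_right _ hx), hh₀.2 x hx]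
    · refine ⟨h, hh, Finset.univ, ?_, fun f _ hf => Set.ext fun x => hf x (Finset.mem_univ x)⟩
      rw [Finset.card_univ, tFun]
      omega

/-- If a finite Boolean pattern `(a_i, ε_i)_{i < m}` is realized by some member of a
family `𝓗` of VC dimension at most `d`, then it is realized by a member `h₀` which is
moreover isolated in `𝓗` by its trace on a set `A₀` of size at most `k = t(d) + m`. -/
theorem exists_isolated_realizing_pattern (d m : ℕ) (A : Type*) [Finite A]
    (𝓗 : Set (Set A)) (hVC : VCDimLE 𝓗 d)
    (a : Fin m → A) (ε : Fin m → Bool)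
    (hcons : ∃ h ∈ 𝓗, ∀ i, (a i ∈ h ↔ ε i = true)) :
    ∃ h₀ ∈ 𝓗, (∀ i, (a i ∈ h₀ ↔ ε i = true)) ∧
      ∃ A₀ : Finset A, A₀.card ≤ tFun d + m ∧
        ∀ h' ∈ 𝓗, h' ∩ ↑A₀ = h₀ ∩ ↑A₀ → h' = h₀ := by
  classical
  obtain ⟨h₀, ⟨hh₀, hpat⟩, Y, hY, hiso⟩ := VCDimLE.exists_isolated d
    (hVC.mono (F := {h ∈ 𝓗 | ∀ i, (a i ∈ h ↔ ε i = true)}) fun _ hf => hf.1) hcons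
  refine ⟨h₀, hh₀, hpat, Y ∪ Finset.univ.image a, ?_, fun h' hh' heq => ?_⟩
  · have h₁ := Finset.card_union_le Y (Finset.univ.image a)
    have h₂ : (Finset.univ.image a).card ≤ m := by
      simpa using Finset.card_image_le (s := Finset.univ) (f := a)
    omega
  · rw [inter_eq_inter_iff_forall_mem] at heq
    refine hiso h' ⟨hh', fun i => ?_⟩ fun x hx => heq x (by simp [hx])
    rw [heq (a i) (by simp), hpat i]
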